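/- The constrained random arrival rule does not satisfy consistency: there exist a multi-issue bankruptcy problem with crossed claims (I, N, E, c, α), a nonempty subset N' ⊂ N, and a claimant j ∈ N' such that CRA_j of the reduced problem on N' (with issue set I' = {i ∈ I : i ∈ α(k) for some k ∈ N'}, endowments e'_i = e_i − ∑_{h ∈ N∖N' : i ∈ α(h)} CRA_h(I,N,E,c,α) for i ∈ I', and claims c restricted to N') differs from CRA_j(I,N,E,c,α). -/

import Mathlib

open Finset

/-- The constrained sequential priority allocation `CSP^σ` of a multi-issue bankruptcy
problem with crossed claims, defined recursively in increasing `σ`-order: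
`CSP^σ_j = min (c j) (max 0 (min_{i ∈ α j} (e i - ∑_{k : i ∈ α k, σ k < σ j} CSP^σ_k)))`.
The minimum over the (nonempty) finite set `α j` is expressed via `sInf`. -/
noncomputable def CSP {I N : Type*} [Fintype I] [Fintype N] [DecidableEq I] [DecidableEq N]
    (e : I → ℝ) (c : N → ℝ) (α : N → Finset I) (σ : N → ℕ) (j : N) : ℝ :=
  min (c j)
    (max 0 (sInf (↑((α j).image fun i =>
      e i - ∑ k ∈ (Finset.univ.filter fun k => i ∈ α k ∧ σ k < σ j).attach,
        CSP e c α σ k.1) : Set ℝ)))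
termination_by σ j
decreasing_by
  have hk := k.2
  simp only [Finset.mem_filter, Finset.mem_univ, true_and] at hk
  exact hk.2

/-- `(I, N, E, c, α)` is a multi-issue bankruptcy problem with crossed claims. -/
def IsMBC {I N : Type*} [Fintype I] [Fintype N] [DecidableEq I] [DecidableEq N]
    (e : I → ℝ) (c : N → ℝ) (α : N → Finset I) : Prop :=
  Nonempty I ∧ Nonempty N ∧ (∀ i, 0 ≤ e i) ∧ (∀ j, 0 ≤ c j) ∧ (∀ j, (α j).Nonempty) ∧
    ∀ i, e i < ∑ j ∈ Finset.univ.filter (fun j => i ∈ α j), c j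

/-- `x` is a feasible allocation of the problem `(I, N, E, c, α)`. -/
def Feasible {I N : Type*} [Fintype I] [Fintype N] [DecidableEq I] [DecidableEq N]
    (e : I → ℝ) (c : N → ℝ) (α : N → Finset I) (x : N → ℝ) : Prop :=
  (∀ j, 0 ≤ x j) ∧ (∀ j, x j ≤ c j) ∧
    ∀ i, ∑ j ∈ Finset.univ.filter (fun j => i ∈ α j), x j ≤ e i

/-- `x` is Pareto efficient: no feasible allocation weakly dominates it with a strict gain. -/
def ParetoEff {I N : Type*} [Fintype I] [Fintype N] [DecidableEq I] [DecidableEq N]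
    (e : I → ℝ) (c : N → ℝ) (α : N → Finset I) (x : N → ℝ) : Prop :=
  ¬ ∃ a : N → ℝ, Feasible e c α a ∧ (∀ j, x j ≤ a j) ∧ ∃ j, x j < a j

/-- The constrained random arrival rule: the average over all `|N|!` orders
(bijections `N ≃ Fin |N|`) of the constrained sequential priority allocations. -/
noncomputable def CRA {I N : Type*} [Fintype I] [Fintype N] [DecidableEq I] [DecidableEq N]
    (e : I → ℝ) (c : N → ℝ) (α : N → Finset I) (j : N) : ℝ :=
  (∑ σ : N ≃ Fin (Fintype.card N), CSP e c α (fun k => (σ k : ℕ)) j) /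
    (Nat.factorial (Fintype.card N) : ℝ)

theorem CSP_first {I N : Type*} [Fintype I] [Fintype N] [DecidableEq I] [DecidableEq N]
    (e : I → ℝ) (c : N → ℝ) (α : N → Finset I) (σ : N → ℕ) (j : N) (v : ℝ)
    (he : ∀ i, e i = v) (hα : (α j).Nonempty) (hσ : ∀ k, ¬ σ k < σ j) :
    CSP e c α σ j = min (c j) (max 0 v) := by
  rw [CSP]
  have h : ((α j).image fun i =>
      e i - ∑ k ∈ (Finset.univ.filter fun k => i ∈ α k ∧ σ k < σ j).attach,
        CSP e c α σ k.1) = {v} := by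
    rw [← Finset.image_const hα v]
    apply Finset.image_congr
    intro i _
    have h0 : (Finset.univ.filter fun k => i ∈ α k ∧ σ k < σ j) = ∅ := by
      apply Finset.filter_eq_empty_iff.2
      intro k _ hk
      exact hσ k hk.2
    simp only [Finset.sum_attach _ (fun k => CSP e c α σ k), h0, he i]
    simp
  rw [h]
  simp

theorem CSP_nonneg {I N : Type*} [Fintype I] [Fintype N] [DecidableEq I] [DecidableEq N]
    (e : I → ℝ) (c : N → ℝ) (α : N → Finset I) (σ : N → ℕ) (j : N) (hc : 0 ≤ c j) :
    0 ≤ CSP e c α σ j := by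
  rw [CSP]
  exact le_min hc (le_max_left _ _)

theorem CSP_blocked {I N : Type*} [Fintype I] [Fintype N] [DecidableEq I] [DecidableEq N]
    (e : I → ℝ) (c : N → ℝ) (α : N → Finset I) (σ : N → ℕ) (j k : N) (i : I)
    (hc : ∀ k, 0 ≤ c k) (hj : i ∈ α j) (hk : i ∈ α k) (hσ : σ k < σ j)
    (h : e i ≤ CSP e c α σ k) :
    CSP e c α σ j = 0 := by
  rw [CSP]
  have h1 : sInf (↑((α j).image fun i =>
      e i - ∑ k ∈ (Finset.univ.filter fun k => i ∈ α k ∧ σ k < σ j).attach,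
        CSP e c α σ k.1) : Set ℝ) ≤ 0 := by
    refine (csInf_le (Finset.bddBelow _) (Finset.mem_coe.2 (Finset.mem_image_of_mem _ hj))).trans ?_
    rw [Finset.sum_attach _ (fun k => CSP e c α σ k)]
    have h2 := Finset.single_le_sum (f := fun k => CSP e c α σ k)
      (s := Finset.univ.filter fun k => i ∈ α k ∧ σ k < σ j)
      (fun k _ => CSP_nonneg e c α σ k (hc k)) (a := k) (by simp [hk, hσ])
    linarith
  rw [max_eq_left h1, min_eq_right (hc j)]

theorem CRA_triangle (j : Fin 3) :
    CRA (fun _ : Fin 3 => (1 : ℝ)) (fun _ : Fin 3 => 1)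
      (fun k : Fin 3 => Finset.univ.erase k) j = 1 / 3 := by
  have key : ∀ σ : Fin 3 ≃ Fin (Fintype.card (Fin 3)),
      CSP (fun _ : Fin 3 => (1 : ℝ)) (fun _ : Fin 3 => 1)
        (fun k : Fin 3 => Finset.univ.erase k) (fun k => (σ k : ℕ)) j
      = if (σ j : ℕ) = 0 then 1 else 0 := by
    intro σ
    have hne : ∀ j : Fin 3, ((Finset.univ : Finset (Fin 3)).erase j).Nonempty := by decide
    have first : ∀ k, (σ k : ℕ) = 0 → CSP (fun _ : Fin 3 => (1 : ℝ)) (fun _ : Fin 3 => 1)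
        (fun k : Fin 3 => Finset.univ.erase k) (fun k => (σ k : ℕ)) k = 1 := by
      intro k hk
      rw [CSP_first _ _ _ _ _ 1 (fun _ => rfl) (hne k) (by intro l; omega)]
      norm_num
    split_ifs with h
    · exact first j h
    · have hk0 : (σ (σ.symm ⟨0, by simp⟩) : ℕ) = 0 := by simp
      generalize σ.symm ⟨0, by simp⟩ = k at hk0
      have hex : ∀ j k : Fin 3, ∃ i, i ∈ (Finset.univ : Finset (Fin 3)).erase j ∧
          i ∈ (Finset.univ : Finset (Fin 3)).erase k := by decide
      obtain ⟨i, hij, hik⟩ := hex j k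
      exact CSP_blocked _ _ _ _ j k i (fun _ => zero_le_one) hij hik
        (by omega) (first k hk0).ge
  unfold CRA
  rw [Finset.sum_congr rfl (fun σ _ => key σ), Finset.sum_boole]
  have hcard : ∀ j : Fin 3, (Finset.univ.filter
      fun σ : Fin 3 ≃ Fin (Fintype.card (Fin 3)) => (σ j : ℕ) = 0).card = 2 := by decide
  rw [hcard j]
  norm_num [Nat.factorial]

/-- the constrained random arrival rule does not satisfy consistency:
there are an MBC problem, a nonempty proper subset `N'` of claimants, and a claimant
`j ∈ N'` whose `CRA` share in the reduced problem on `N'` (issues claimed by some member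
of `N'`, endowments diminished by what the leaving claimants received under `CRA`,
claims and `α` restricted to `N'`) differs from her `CRA` share in the original problem. -/
theorem CRA_not_consistent :
    ∃ (nI nN : ℕ) (e : Fin nI → ℝ) (c : Fin nN → ℝ) (α : Fin nN → Finset (Fin nI)),
      IsMBC e c α ∧
      ∃ (N' : Finset (Fin nN)), N'.Nonempty ∧ N' ⊂ Finset.univ ∧
      ∃ (j : {x // x ∈ N'}),
        CRA (I := {i // i ∈ Finset.univ.filter fun i : Fin nI => ∃ k ∈ N', i ∈ α k})
          (fun i => e i.1 - ∑ h ∈ Finset.univ.filter (fun h => h ∉ N' ∧ i.1 ∈ α h),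
            CRA e c α h)
          (fun k => c k.1)
          (fun k => (α k.1).subtype fun i =>
            i ∈ Finset.univ.filter fun i : Fin nI => ∃ k ∈ N', i ∈ α k)
          j
        ≠ CRA e c α j.1 := by
  refine ⟨3, 3, fun _ => 1, fun _ => 1, fun k => Finset.univ.erase k, ?_, {0}, by simp, ?_,
    ⟨0, by simp⟩, ?_⟩
  · refine ⟨⟨0⟩, ⟨0⟩, fun _ => zero_le_one, fun _ => zero_le_one, by decide, ?_⟩
    intro i
    have hcard : ∀ i : Fin 3, (Finset.univ.filter
      fun j : Fin 3 => i ∈ (Finset.univ : Finset (Fin 3)).erase j).card = 2 := by decide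
    rw [Finset.sum_const, hcard i]
    norm_num
  · decide
  · rw [CRA_triangle]
    simp only [CRA_triangle]
    rw [CRA]
    have hv : ∀ i : {i // i ∈ Finset.univ.filter fun i : Fin 3 =>
        ∃ k ∈ ({0} : Finset (Fin 3)), i ∈ (Finset.univ : Finset (Fin 3)).erase k},
        (1 : ℝ) - ∑ h ∈ Finset.univ.filter (fun h : Fin 3 => h ∉ ({0} : Finset (Fin 3)) ∧
          i.1 ∈ (Finset.univ : Finset (Fin 3)).erase h), (1 / 3 : ℝ) = 2 / 3 := by
      intro i
      have hcard : ∀ i : {i // i ∈ Finset.univ.filter fun i : Fin 3 =>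
        ∃ k ∈ ({0} : Finset (Fin 3)), i ∈ (Finset.univ : Finset (Fin 3)).erase k},
        (Finset.univ.filter (fun h : Fin 3 => h ∉ ({0} : Finset (Fin 3)) ∧
          i.1 ∈ (Finset.univ : Finset (Fin 3)).erase h)).card = 1 := by decide
      rw [Finset.sum_const, hcard i]
      norm_num
    rw [Finset.sum_congr rfl (fun σ _ => CSP_first _ _ _ _ _ (2 / 3) hv (by decide) ?_)]
    · rw [Finset.sum_const, Finset.card_univ, Fintype.card_equiv (Fintype.equivFin _)]
      norm_num
    · rintro ⟨k, hk⟩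
      obtain rfl := Finset.mem_singleton.1 hk
      exact lt_irrefl _
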